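/- Let K and C be closed convex cones in ℝ^d (both containing 0) and let W ⊆ ℝ^d be a nonempty convex cone. If ri(K*) ∩ ri(W − C) ≠ ∅, then (ri(K*) ∩ ri(W − C))* = K + (W* ∩ (−C*)). -/

import Mathlib

open Set Pointwise

namespace MSPPaper

/-- The positive polar cone of a subset of `ℝ^d`. -/
def polar {d : ℕ} (B : Set (Fin d → ℝ)) : Set (Fin d → ℝ) :=
  {y | ∀ x ∈ B, 0 ≤ ∑ i, y i * x i}

/-- A closed convex cone (containing the origin). -/
def IsClosedConvexCone {d : ℕ} (A : Set (Fin d → ℝ)) : Prop :=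
  IsClosed A ∧ Convex ℝ A ∧ (0 : Fin d → ℝ) ∈ A ∧ ∀ c : ℝ, 0 < c → ∀ x ∈ A, c • x ∈ A

section IntrinsicInterior

open Topology Filter

variable {E : Type*} [AddCommGroup E] [Module ℝ E] [TopologicalSpace E]

theorem mem_intrinsicInterior_iff_nhdsWithin {s : Set E} {x : E} :
    x ∈ intrinsicInterior ℝ s ↔ x ∈ affineSpan ℝ s ∧ s ∈ 𝓝[affineSpan ℝ s] x := by
  rw [mem_intrinsicInterior]
  constructor
  · rintro ⟨y, hy, rfl⟩
    exact ⟨y.2, preimage_coe_mem_nhds_subtype.1 (mem_interior_iff_mem_nhds.1 hy)⟩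
  · rintro ⟨hx, hs⟩
    exact ⟨⟨x, hx⟩, mem_interior_iff_mem_nhds.2 (preimage_coe_mem_nhds_subtype.2 hs), rfl⟩

variable [IsTopologicalAddGroup E] [ContinuousSMul ℝ E]

/-- A segment of `s` ending at a relative interior point can be prolonged within `s`. -/
theorem eventually_lineMap_mem_of_mem_intrinsicInterior {s : Set E} {x y : E}
    (hx : x ∈ intrinsicInterior ℝ s) (hy : y ∈ s) :
    ∀ᶠ t in 𝓝 (0 : ℝ), AffineMap.lineMap x y t ∈ s := by
  obtain ⟨hxs, hs⟩ := mem_intrinsicInterior_iff_nhdsWithin.1 hx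
  have hcont : Tendsto (fun t : ℝ => AffineMap.lineMap x y t) (𝓝 0) (𝓝 x) := by
    have h : Continuous fun t : ℝ => t • (y - x) + x := by fun_prop
    simpa [AffineMap.lineMap_apply] using h.tendsto 0
  exact (tendsto_nhdsWithin_iff.2 ⟨hcont, Eventually.of_forall fun t =>
    AffineMap.lineMap_mem t hxs (subset_affineSpan ℝ s hy)⟩) hs

/-- The line segment principle for relative interiors. -/
theorem lineMap_mem_intrinsicInterior {s : Set E} (hs : Convex ℝ s) {x y : E}
    (hx : x ∈ intrinsicInterior ℝ s) (hy : y ∈ s) {t : ℝ} (ht : 0 < t) (ht1 : t ≤ 1) :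
    AffineMap.lineMap y x t ∈ intrinsicInterior ℝ s := by
  obtain ⟨hxs, hsx⟩ := mem_intrinsicInterior_iff_nhdsWithin.1 hx
  have hys := subset_affineSpan ℝ s hy
  refine mem_intrinsicInterior_iff_nhdsWithin.2 ⟨AffineMap.lineMap_mem t hys hxs, ?_⟩
  have hlim : Tendsto (fun p : E => AffineMap.lineMap y p t⁻¹)
      (𝓝[affineSpan ℝ s] (AffineMap.lineMap y x t)) (𝓝[affineSpan ℝ s] x) := by
    refine tendsto_nhdsWithin_iff.2 ⟨?_, ?_⟩
    · have h : Continuous fun p : E => t⁻¹ • (p - y) + y := by fun_prop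
      have h' := (h.tendsto (AffineMap.lineMap y x t)).mono_left
        (nhdsWithin_le_nhds (s := affineSpan ℝ s))
      simpa [AffineMap.lineMap_apply, smul_smul, ht.ne'] using h'
    · exact eventually_mem_nhdsWithin.mono fun p hp => AffineMap.lineMap_mem _ hys hp
  filter_upwards [hlim hsx] with p hp
  have h := hs.lineMap_mem hy hp ⟨ht.le, ht1⟩
  simpa [AffineMap.lineMap_apply, smul_smul, ht.ne'] using h

/-- A continuous function which is nonnegative on `ri s ∩ ri t ≠ ∅` is nonnegative on `s ∩ t`. -/
theorem nonneg_of_nonneg_on_intrinsicInterior_inter {s t : Set E} (hs : Convex ℝ s)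
    (ht : Convex ℝ t) (hne : (intrinsicInterior ℝ s ∩ intrinsicInterior ℝ t).Nonempty)
    {f : E → ℝ} (hf : Continuous f)
    (hpos : ∀ x ∈ intrinsicInterior ℝ s ∩ intrinsicInterior ℝ t, 0 ≤ f x) {x : E}
    (hxs : x ∈ s) (hxt : x ∈ t) : 0 ≤ f x := by
  obtain ⟨y, hys, hyt⟩ := hne
  have hlim : Tendsto (fun r : ℝ => f (AffineMap.lineMap x y r)) (𝓝[>] 0) (𝓝 (f x)) := by
    have h : Continuous fun r : ℝ => f (r • (y - x) + x) := by fun_prop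
    simpa [AffineMap.lineMap_apply] using (h.tendsto 0).mono_left nhdsWithin_le_nhds
  refine ge_of_tendsto hlim ?_
  filter_upwards [Ioc_mem_nhdsGT (zero_lt_one' ℝ)] with r hr
  exact hpos _ ⟨lineMap_mem_intrinsicInterior hs hys hxs hr.1 hr.2,
    lineMap_mem_intrinsicInterior ht hyt hxt hr.1 hr.2⟩

end IntrinsicInterior

section Cones

open Topology Filter

variable {E : Type*} [AddCommGroup E] [Module ℝ E]

/-- Adjoining the origin to a convex cone gives a pointed cone. -/
theorem exists_pointedCone_mem_iff {s : Set E} (hs : Convex ℝ s)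
    (hcone : ∀ c : ℝ, 0 < c → ∀ x ∈ s, c • x ∈ s) :
    ∃ P : PointedCone ℝ E, ∀ x, x ∈ P ↔ x = 0 ∨ x ∈ s := by
  refine ⟨{ carrier := {x | x = 0 ∨ x ∈ s}, zero_mem' := Or.inl rfl, add_mem' := ?_,
            smul_mem' := ?_ }, fun x => Iff.rfl⟩
  · rintro a b (rfl | ha) (rfl | hb)
    · exact Or.inl (add_zero 0)
    · exact Or.inr (by simpa using hb)
    · exact Or.inr (by simpa using ha)
    · have h := hcone 2 two_pos _
        (hs ha hb (by norm_num : (0 : ℝ) ≤ 1 / 2) (by norm_num : (0 : ℝ) ≤ 1 / 2) (by norm_num))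
      rw [smul_add, smul_smul, smul_smul] at h
      norm_num at h
      exact Or.inr h
  · rintro ⟨c, hc⟩ x (rfl | hx)
    · exact Or.inl (smul_zero _)
    · rcases eq_or_lt_of_le hc with rfl | hc'
      · exact Or.inl (zero_smul ℝ x)
      · exact Or.inr (hcone c hc' x hx)

/-- If the difference of two cones is a linear subspace, then a linear functional which is
nonnegative on their intersection is a sum of functionals nonnegative on the respective cones. -/
theorem exists_add_eq_of_nonneg_on_inter (P Q : PointedCone ℝ E)
    (hneg : ∀ a ∈ P, ∀ b ∈ Q, ∃ a' ∈ P, ∃ b' ∈ Q, a - b = b' - a')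
    (f : E →ₗ[ℝ] ℝ) (hf : ∀ x ∈ P, x ∈ Q → 0 ≤ f x) :
    ∃ g h : E →ₗ[ℝ] ℝ, g + h = f ∧ (∀ x ∈ P, 0 ≤ g x) ∧ ∀ x ∈ Q, 0 ≤ h x := by
  let L : Submodule ℝ E :=
    { carrier := {u | ∃ a ∈ P, ∃ b ∈ Q, b - a = u}
      zero_mem' := ⟨0, P.zero_mem, 0, Q.zero_mem, sub_zero 0⟩
      add_mem' := by
        rintro _ _ ⟨a, ha, b, hb, rfl⟩ ⟨a', ha', b', hb', rfl⟩
        exact ⟨a + a', P.add_mem ha ha', b + b', Q.add_mem hb hb', by abel⟩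
      smul_mem' := by
        rintro c _ ⟨a, ha, b, hb, rfl⟩
        rcases le_total 0 c with hc | hc
        · exact ⟨c • a, P.smul_mem hc ha, c • b, Q.smul_mem hc hb, (smul_sub _ _ _).symm⟩
        · obtain ⟨a', ha', b', hb', h⟩ := hneg a ha b hb
          refine ⟨(-c) • a', P.smul_mem (neg_nonneg.2 hc) ha', (-c) • b',
            Q.smul_mem (neg_nonneg.2 hc) hb', ?_⟩
          rw [← smul_sub, ← h, neg_smul, ← smul_neg, neg_sub] }
  obtain ⟨M, hM⟩ := L.exists_isCompl
  let D : Submodule ℝ (E × E) := M.comap (LinearMap.snd ℝ E E - LinearMap.fst ℝ E E)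
  obtain ⟨φ, hφf, hφ⟩ := riesz_extension (P.prod Q) ⟨D, (f ∘ₗ LinearMap.fst ℝ E E) ∘ₗ D.subtype⟩
    (by
      rintro ⟨⟨u, v⟩, huv⟩ ⟨hu, hv⟩
      have h0 : v - u = 0 := by
        have : v - u ∈ L ⊓ M := ⟨⟨u, hu, v, hv, rfl⟩, huv⟩
        rwa [hM.inf_eq_bot] at this
      obtain rfl : v = u := sub_eq_zero.1 h0
      exact hf v hu hv)
    (by
      rintro ⟨u, v⟩
      obtain ⟨l, ⟨a, ha, b, hb, rfl⟩, m, hm, hlm⟩ :=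
        Submodule.mem_sup.1 (hM.sup_eq_top ▸ Submodule.mem_top : v - u ∈ L ⊔ M)
      refine ⟨⟨(a - u, b - v), ?_⟩, ?_⟩
      · change b - v - (a - u) ∈ M
        have : b - v - (a - u) = -m := by
          rw [eq_neg_iff_add_eq_zero, ← sub_eq_zero.2 hlm]; abel
        rw [this]
        exact M.neg_mem hm
      · exact ⟨by simpa using ha, by simpa using hb⟩)
  refine ⟨φ ∘ₗ LinearMap.inl ℝ E E, φ ∘ₗ LinearMap.inr ℝ E E, ?_,
    fun x hx => hφ (x, 0) ⟨hx, Q.zero_mem⟩, fun x hx => hφ (0, x) ⟨P.zero_mem, hx⟩⟩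
  ext x
  have h := hφf ⟨(x, x), by simp [D]⟩
  simpa [← map_add] using h

variable [TopologicalSpace E] [IsTopologicalAddGroup E] [ContinuousSMul ℝ E]

theorem eventually_add_smul_sub_mem {s : Set E}
    (hcone : ∀ c : ℝ, 0 < c → ∀ x ∈ s, c • x ∈ s) {x a : E} (hx : x ∈ intrinsicInterior ℝ s)
    (ha : a = 0 ∨ a ∈ s) : ∀ᶠ t in 𝓝[>] (0 : ℝ), (1 + t) • x - t • a ∈ s := by
  rcases ha with rfl | ha
  · filter_upwards [self_mem_nhdsWithin] with t (ht : 0 < t)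
    simpa using hcone (1 + t) (by positivity) x (intrinsicInterior_subset hx)
  · have hlim : Tendsto (fun t : ℝ => -t) (𝓝[>] 0) (𝓝 0) := by
      simpa using (continuous_neg.tendsto (0 : ℝ)).mono_left nhdsWithin_le_nhds
    filter_upwards [hlim.eventually (eventually_lineMap_mem_of_mem_intrinsicInterior hx ha)]
      with t ht
    convert ht using 1
    rw [AffineMap.lineMap_apply_module']
    module

/-- A continuous linear functional nonnegative on the intersection of the relative interiors of two
convex cones, if that is nonempty, is a sum of functionals nonnegative on the respective cones. -/
theorem exists_add_eq_of_nonneg_on_intrinsicInterior_inter {s t : Set E}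
    (hs : Convex ℝ s) (hscone : ∀ c : ℝ, 0 < c → ∀ x ∈ s, c • x ∈ s)
    (ht : Convex ℝ t) (htcone : ∀ c : ℝ, 0 < c → ∀ x ∈ t, c • x ∈ t)
    (hne : (intrinsicInterior ℝ s ∩ intrinsicInterior ℝ t).Nonempty)
    (f : E →L[ℝ] ℝ) (hf : ∀ x ∈ intrinsicInterior ℝ s ∩ intrinsicInterior ℝ t, 0 ≤ f x) :
    ∃ g h : E →ₗ[ℝ] ℝ, g + h = f ∧ (∀ x ∈ s, 0 ≤ g x) ∧ ∀ x ∈ t, 0 ≤ h x := by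
  obtain ⟨P, hP⟩ := exists_pointedCone_mem_iff hs hscone
  obtain ⟨Q, hQ⟩ := exists_pointedCone_mem_iff ht htcone
  obtain ⟨x₀, hxs, hxt⟩ := id hne
  obtain ⟨g, h, hgh, hg, hh⟩ := exists_add_eq_of_nonneg_on_inter P Q (fun a ha b hb => by
      obtain ⟨r, ⟨hra, hrb⟩, hr⟩ :=
        (((eventually_add_smul_sub_mem hscone hxs ((hP a).1 ha)).and
          (eventually_add_smul_sub_mem htcone hxt ((hQ b).1 hb))).and
            self_mem_nhdsWithin).exists
      replace hr : 0 < r := hr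
      refine ⟨r⁻¹ • ((1 + r) • x₀ - r • a), (hP _).2 (Or.inr (hscone _ (inv_pos.2 hr) _ hra)),
        r⁻¹ • ((1 + r) • x₀ - r • b), (hQ _).2 (Or.inr (htcone _ (inv_pos.2 hr) _ hrb)), ?_⟩
      rw [← smul_sub, sub_sub_sub_cancel_left, ← smul_sub, inv_smul_smul₀ hr.ne'])
    (f : E →ₗ[ℝ] ℝ) (fun x hx hx' => by
      rcases (hP x).1 hx with rfl | hx
      · simp
      rcases (hQ x).1 hx' with rfl | hx'
      · simp
      exact nonneg_of_nonneg_on_intrinsicInterior_inter hs ht hne f.continuous hf hx hx')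
  exact ⟨g, h, hgh, fun x hx => hg x ((hP x).2 (Or.inr hx)),
    fun x hx => hh x ((hQ x).2 (Or.inr hx))⟩

end Cones

section Polar

variable {d : ℕ}

theorem exists_vector_repr (f : (Fin d → ℝ) →ₗ[ℝ] ℝ) :
    ∃ y : Fin d → ℝ, ∀ x, f x = ∑ i, y i * x i :=
  ⟨fun i => f fun j => if i = j then 1 else 0, fun x => by
    simp_rw [f.pi_apply_eq_sum_univ x, smul_eq_mul, mul_comm]⟩

theorem convex_polar (s : Set (Fin d → ℝ)) : Convex ℝ (polar s) := by
  intro y hy z hz a b ha hb _ x hx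
  have h := add_nonneg (mul_nonneg ha (hy x hx)) (mul_nonneg hb (hz x hx))
  simpa [Finset.mul_sum, add_mul, Finset.sum_add_distrib, mul_assoc] using h

theorem smul_mem_polar {s : Set (Fin d → ℝ)} {c : ℝ} (hc : 0 ≤ c) {y : Fin d → ℝ}
    (hy : y ∈ polar s) : c • y ∈ polar s := by
  intro x hx
  simpa [Finset.mul_sum, mul_assoc] using mul_nonneg hc (hy x hx)

theorem subset_polar_polar (s : Set (Fin d → ℝ)) : s ⊆ polar (polar s) := by
  intro x hx y hy
  simpa [mul_comm] using hy x hx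

theorem polar_polar_eq {s : Set (Fin d → ℝ)} (hs : IsClosedConvexCone s) :
    polar (polar s) = s := by
  obtain ⟨hclosed, hconv, h0, hcone⟩ := hs
  refine (subset_polar_polar s).antisymm' fun x hx => ?_
  by_contra hxs
  obtain ⟨P, hP⟩ := exists_pointedCone_mem_iff hconv hcone
  have hPs : (P : Set (Fin d → ℝ)) = s := by
    ext z
    exact (hP z).trans (or_iff_right_of_imp fun h => h ▸ h0)
  let C : ProperCone ℝ (Fin d → ℝ) := ⟨P, by simpa [hPs] using hclosed⟩
  have hxC : x ∉ C := fun h => hxs (hPs ▸ h)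
  obtain ⟨f, hf, hfx⟩ := C.hyperplane_separation_point hxC
  obtain ⟨y, hy⟩ := exists_vector_repr (f : (Fin d → ℝ) →ₗ[ℝ] ℝ)
  have hys : y ∈ polar s := fun z hz => (hy z) ▸ hf z (show z ∈ (P : Set _) from hPs ▸ hz)
  have h1 := hx y hys
  have h2 := hy x
  simp_rw [mul_comm] at h1 h2
  simp only [ContinuousLinearMap.coe_coe] at h2
  linarith

/-- The polar of the difference of two cones. -/
theorem polar_sub {s t : Set (Fin d → ℝ)} (hsne : s.Nonempty)
    (hscone : ∀ c : ℝ, 0 < c → ∀ x ∈ s, c • x ∈ s) (ht : IsClosedConvexCone t) :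
    polar (s - t) = polar s ∩ -polar t := by
  obtain ⟨-, -, h0, -⟩ := ht
  have hsub : ∀ y w c : Fin d → ℝ,
      ∑ i, y i * (w - c) i = ∑ i, y i * w i - ∑ i, y i * c i := fun y w c => by
    simp [mul_sub, Finset.sum_sub_distrib]
  ext y
  constructor
  · intro hy
    refine ⟨fun w hw => by simpa using hy (w - 0) (sub_mem_sub hw h0), fun c hc => ?_⟩
    obtain ⟨w, hw⟩ := hsne
    have key : ∀ r : ℝ, 0 < r → ∑ i, y i * c i ≤ r * ∑ i, y i * w i := fun r hr => by
      have h := hy _ (sub_mem_sub (hscone r hr w hw) hc)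
      rw [hsub, sub_nonneg] at h
      simpa [Finset.mul_sum, mul_left_comm] using h
    have hlim : Filter.Tendsto (fun r : ℝ => r * ∑ i, y i * w i) (nhdsWithin 0 (Ioi 0))
        (nhds 0) := by
      simpa using ((continuous_mul_const (∑ i, y i * w i)).tendsto (0 : ℝ)).mono_left
        nhdsWithin_le_nhds
    have := ge_of_tendsto hlim (Filter.eventually_of_mem self_mem_nhdsWithin key)
    simpa using this
  · rintro ⟨hys, hyt⟩ _ ⟨w, hw, c, hc, rfl⟩
    have h1 := hys w hw
    have h2 := hyt c hc
    simp only [Pi.neg_apply, neg_mul, Finset.sum_neg_distrib] at h2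
    rw [hsub]
    linarith

/-- The polar of the intersection of the relative interiors of two convex cones. -/
theorem polar_intrinsicInterior_inter {s t : Set (Fin d → ℝ)}
    (hs : Convex ℝ s) (hscone : ∀ c : ℝ, 0 < c → ∀ x ∈ s, c • x ∈ s)
    (ht : Convex ℝ t) (htcone : ∀ c : ℝ, 0 < c → ∀ x ∈ t, c • x ∈ t)
    (hne : (intrinsicInterior ℝ s ∩ intrinsicInterior ℝ t).Nonempty) :
    polar (intrinsicInterior ℝ s ∩ intrinsicInterior ℝ t) = polar s + polar t := by
  ext y
  constructor
  · intro hy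
    let f : (Fin d → ℝ) →L[ℝ] ℝ := ∑ i, y i • ContinuousLinearMap.proj i
    have hfapp : ∀ x, f x = ∑ i, y i * x i := fun x => by simp [f]
    obtain ⟨g, h, hgh, hg, hh⟩ := exists_add_eq_of_nonneg_on_intrinsicInterior_inter
      hs hscone ht htcone hne f (fun x hx => by rw [hfapp]; exact hy x hx)
    obtain ⟨k, hk⟩ := exists_vector_repr g
    obtain ⟨z, hz⟩ := exists_vector_repr h
    refine ⟨k, fun x hx => hk x ▸ hg x hx, z, fun x hx => hz x ▸ hh x hx, ?_⟩
    ext i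
    have h1 := LinearMap.congr_fun hgh (Pi.single i 1)
    simpa [hk, hz, hfapp, Pi.single_apply] using h1
  · rintro ⟨k, hk, z, hz, rfl⟩ x ⟨hxs, hxt⟩
    have h := add_nonneg (hk x (intrinsicInterior_subset hxs)) (hz x (intrinsicInterior_subset hxt))
    simpa [add_mul, Finset.sum_add_distrib] using h

end Polar

/-- Lemma 5.8: if `ri(K*) ∩ ri(W − C) ≠ ∅`, then
`(ri(K*) ∩ ri(W − C))* = K + (W* ∩ (−C*))`. -/
theorem polar_of_ri_inter
    (d : ℕ) (K C : Set (Fin d → ℝ))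
    (hK : IsClosedConvexCone K) (hC : IsClosedConvexCone C)
    (W : Set (Fin d → ℝ)) (hWne : W.Nonempty) (hWconv : Convex ℝ W)
    (hWcone : ∀ c : ℝ, 0 < c → ∀ x ∈ W, c • x ∈ W)
    (hne : (intrinsicInterior ℝ (polar K) ∩ intrinsicInterior ℝ (W - C)).Nonempty) :
    polar (intrinsicInterior ℝ (polar K) ∩ intrinsicInterior ℝ (W - C)) =
      K + (polar W ∩ -polar C) := by
  rw [polar_intrinsicInterior_inter (convex_polar K) (fun c hc x hx => smul_mem_polar hc.le hx)
    (hWconv.sub hC.2.1) _ hne, polar_polar_eq hK, polar_sub hWne hWcone hC]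
  rintro r hr _ ⟨w, hw, c, hc, rfl⟩
  exact ⟨r • w, hWcone r hr w hw, r • c, hC.2.2.2 r hr c hc, (smul_sub r w c).symm⟩

end MSPPaper
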